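/- Let ρ be the discrete polymatroid rank function on {1,2,3} given by ρ({1}) = ρ({2}) = ρ({2,3}) = 2, ρ({3}) = 1, and ρ({1,2}) = ρ({1,3}) = ρ({1,2,3}) = 3. Then: (a) ρ is representable over F_2 (for instance by the subspaces of F_2^3 spanned by the columns of A_1 = [e_1 e_2], A_2 = [e_3, (1,1,1)^T], A_3 = [e_3]); yet (b) the generalized index coding problem I_D constructed from ρ has NO perfect scalar linear index code over F_2, i.e. no linear index code of length 5 and dimension 1 over F_2 solves I_D. Hence the converse of the representability theorem for the construction I_D fails: representability of the discrete polymatroid over F_2 does not imply the existence of a perfect linear solution. -/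

import Mathlib

/-- `ρ` is a discrete polymatroid rank function: normalized, monotone and submodular. -/
def DPRankFn {r : ℕ} (ρ : Finset (Fin r) → ℕ) : Prop :=
  ρ ∅ = 0 ∧ (∀ A B : Finset (Fin r), A ⊆ B → ρ A ≤ ρ B) ∧
    ∀ A B : Finset (Fin r), ρ (A ∪ B) + ρ (A ∩ B) ≤ ρ A + ρ B

/-- Membership in the discrete polymatroid associated to `ρ`. -/
def MemDP {r : ℕ} (ρ : Finset (Fin r) → ℕ) (u : Fin r → ℕ) : Prop :=
  ∀ A : Finset (Fin r), ∑ i ∈ A, u i ≤ ρ A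

/-- A basis vector of the discrete polymatroid: a maximal element of `D`. -/
def IsBasisVec {r : ℕ} (ρ : Finset (Fin r) → ℕ) (b : Fin r → ℕ) : Prop :=
  MemDP ρ b ∧ ∀ v : Fin r → ℕ, MemDP ρ v → b ≤ v → v = b

/-- A minimal excluded vector of the discrete polymatroid. -/
def IsMinExcludedVec {r : ℕ} (ρ : Finset (Fin r) → ℕ) (c : Fin r → ℕ) : Prop :=
  ¬ MemDP ρ c ∧ (∀ i : Fin r, c i ≤ ρ {i}) ∧
    ∀ v : Fin r → ℕ, v ≤ c → ¬ MemDP ρ v → v = c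

/-- The message tuples of the problem `I_D` constructed from `ρ`, with messages of
dimension `n` over `F`. -/
abbrev DPMsg {r : ℕ} (ρ : Finset (Fin r) → ℕ) (n : ℕ) (F : Type*) : Type _ :=
  (Fin (ρ Finset.univ) → Fin n → F) × ((i : Fin r) → Fin (ρ {i}) → Fin n → F)

/-- `f` solves the generalized index coding problem `I_D` constructed from `ρ`: every
receiver of the three types `R1`, `R2`, `R3` can compute its demand from its side
information together with `f`. -/
def SolvesDP {r n l : ℕ} {F : Type*} [Field F] (ρ : Finset (Fin r) → ℕ)
    (f : DPMsg ρ n F → (Fin l → F)) : Prop :=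
  (∀ b : Fin r → ℕ, IsBasisVec ρ b → ∀ j : Fin (ρ Finset.univ),
    ∀ η : (i : Fin r) → Finset (Fin (ρ {i})), (∀ i : Fin r, (η i).card = b i) →
    ∃ ψ : ((i : Fin r) → {p // p ∈ η i} → Fin n → F) → (Fin l → F) → (Fin n → F),
      ∀ z : DPMsg ρ n F, ψ (fun i p => z.2 i p) (f z) = z.1 j) ∧
  (∀ c : Fin r → ℕ, IsMinExcludedVec ρ c → ∀ j : Fin r, c j ≠ 0 → ∀ p : Fin (ρ {j}),
    ∀ η : (i : Fin r) → Finset (Fin (ρ {i})),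
      (∀ i : Fin r, i ≠ j → (η i).card = c i) → p ∉ η j → (η j).card = c j - 1 →
    ∃ ψ : (Fin n → F) → (Fin l → F) → (Fin n → F),
      ∀ z : DPMsg ρ n F, ψ (∑ i : Fin r, ∑ q ∈ η i, z.2 i q) (f z) = z.2 j p) ∧
  (∀ (i : Fin r) (p : Fin (ρ {i})),
    ∃ ψ : (Fin (ρ Finset.univ) → Fin n → F) → (Fin l → F) → (Fin n → F),
      ∀ z : DPMsg ρ n F, ψ z.1 (f z) = z.2 i p)

/-- The eight subsets of `Fin 3`. -/
theorem finset_fin_three_cases (A : Finset (Fin 3)) :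
    A = ∅ ∨ A = {0} ∨ A = {1} ∨ A = {2} ∨ A = {0, 1} ∨ A = {0, 2} ∨ A = {1, 2} ∨
      A = {0, 1, 2} := by
  revert A
  decide

/-- On a three-element ground set, membership in a discrete polymatroid amounts to seven
inequalities. -/
theorem memDP_fin_three_iff (ρ : Finset (Fin 3) → ℕ) (u : Fin 3 → ℕ) :
    MemDP ρ u ↔ u 0 ≤ ρ {0} ∧ u 1 ≤ ρ {1} ∧ u 2 ≤ ρ {2} ∧ u 0 + u 1 ≤ ρ {0, 1} ∧
      u 0 + u 2 ≤ ρ {0, 2} ∧ u 1 + u 2 ≤ ρ {1, 2} ∧ u 0 + (u 1 + u 2) ≤ ρ {0, 1, 2} := by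
  constructor
  · intro h
    refine ⟨?_, ?_, ?_, ?_, ?_, ?_, ?_⟩
    · simpa using h {0}
    · simpa using h {1}
    · simpa using h {2}
    · simpa using h {0, 1}
    · simpa using h {0, 2}
    · simpa using h {1, 2}
    · simpa using h {0, 1, 2}
  · rintro ⟨h0, h1, h2, h01, h02, h12, h⟩ A
    rcases finset_fin_three_cases A with rfl | rfl | rfl | rfl | rfl | rfl | rfl | rfl <;> simp [*]

/-- The subspaces spanned by the columns of `[e₁ e₂]`, `[e₃ (1,1,1)ᵀ]` and `[e₃]`. -/
def columnSpaces : Fin 3 → Submodule (ZMod 2) (Fin 3 → ZMod 2) :=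
  ![Submodule.span (ZMod 2) {![1, 0, 0], ![0, 1, 0]},
    Submodule.span (ZMod 2) {![0, 0, 1], ![1, 1, 1]},
    Submodule.span (ZMod 2) {![0, 0, 1]}]

theorem finrank_columnSpaces_zero : Module.finrank (ZMod 2) (columnSpaces 0) = 2 := by
  have h : LinearIndependent (ZMod 2) ![(![1, 0, 0] : Fin 3 → ZMod 2), ![0, 1, 0]] := by
    rw [LinearIndependent.pair_iff]
    decide
  have hr := finrank_span_eq_card h
  rwa [Matrix.range_cons_cons_empty, Fintype.card_fin] at hr

theorem finrank_columnSpaces_one : Module.finrank (ZMod 2) (columnSpaces 1) = 2 := by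
  have h : LinearIndependent (ZMod 2) ![(![0, 0, 1] : Fin 3 → ZMod 2), ![1, 1, 1]] := by
    rw [LinearIndependent.pair_iff]
    decide
  have hr := finrank_span_eq_card h
  rwa [Matrix.range_cons_cons_empty, Fintype.card_fin] at hr

theorem finrank_columnSpaces_two : Module.finrank (ZMod 2) (columnSpaces 2) = 1 :=
  finrank_span_singleton (by decide)

theorem columnSpaces_two_le_one : columnSpaces 2 ≤ columnSpaces 1 :=
  Submodule.span_mono (by simp)

theorem columnSpaces_zero_sup_two : columnSpaces 0 ⊔ columnSpaces 2 = ⊤ := by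
  refine eq_top_iff.2 fun v _ => Submodule.mem_sup.2 ⟨![v 0, v 1, 0], ?_, ![0, 0, v 2], ?_, ?_⟩
  · exact Submodule.mem_span_pair.2 ⟨v 0, v 1, by simp⟩
  · exact Submodule.mem_span_singleton.2 ⟨v 2, by simp⟩
  · ext i
    fin_cases i <;> simp

theorem columnSpaces_zero_sup_one : columnSpaces 0 ⊔ columnSpaces 1 = ⊤ :=
  top_le_iff.1 (columnSpaces_zero_sup_two ▸ sup_le_sup_left columnSpaces_two_le_one _)

theorem isBasisVec_one_two_zero {ρ : Finset (Fin 3) → ℕ}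
    (h1 : ρ {0} = 2) (h2 : ρ {1} = 2) (h3 : ρ {2} = 1)
    (h12 : ρ {0, 1} = 3) (h13 : ρ {0, 2} = 3) (h23 : ρ {1, 2} = 2)
    (h123 : ρ {0, 1, 2} = 3) : IsBasisVec ρ ![1, 2, 0] := by
  refine ⟨by simp [memDP_fin_three_iff, *], fun v hv hle => ?_⟩
  rw [memDP_fin_three_iff] at hv
  have l0 : 1 ≤ v 0 := hle 0
  have l1 : 2 ≤ v 1 := hle 1
  ext i
  fin_cases i <;> simp <;> omega

theorem isMinExcludedVec_two_one_one {ρ : Finset (Fin 3) → ℕ}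
    (h1 : ρ {0} = 2) (h2 : ρ {1} = 2) (h3 : ρ {2} = 1)
    (h12 : ρ {0, 1} = 3) (h13 : ρ {0, 2} = 3) (h23 : ρ {1, 2} = 2)
    (h123 : ρ {0, 1, 2} = 3) : IsMinExcludedVec ρ ![2, 1, 1] := by
  refine ⟨by simp [memDP_fin_three_iff, *], fun i => ?_, fun v hle hv => ?_⟩
  · fin_cases i <;> simp [*]
  · rw [memDP_fin_three_iff] at hv
    have l0 : v 0 ≤ 2 := hle 0
    have l1 : v 1 ≤ 1 := hle 1
    have l2 : v 2 ≤ 1 := hle 2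
    ext i
    fin_cases i <;> simp <;> omega

/-- Let `ρ` be the discrete polymatroid rank function on `{1,2,3}`
(here `Fin 3`) with `ρ {1} = ρ {2} = ρ {2,3} = 2`, `ρ {3} = 1`,
`ρ {1,2} = ρ {1,3} = ρ {1,2,3} = 3`.  Then (a) `ρ` is representable over `F₂`, yet
(b) the generalized index coding problem `I_D` constructed from `ρ` has no perfect
scalar linear index code over `F₂`, i.e. no linear index code of length `5` and
dimension `1` solves it.  Hence the converse of the representability theorem for the
construction `I_D` fails. -/
theorem stmt_13 (ρ : Finset (Fin 3) → ℕ) (hρ : DPRankFn ρ)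
    (h1 : ρ {0} = 2) (h2 : ρ {1} = 2) (h3 : ρ {2} = 1)
    (h12 : ρ {0, 1} = 3) (h13 : ρ {0, 2} = 3) (h23 : ρ {1, 2} = 2)
    (h123 : ρ {0, 1, 2} = 3) :
    (∃ (N : ℕ) (V : Fin 3 → Submodule (ZMod 2) (Fin N → ZMod 2)),
      ∀ S : Finset (Fin 3),
        Module.finrank (ZMod 2) ↥(∑ i ∈ S, V i) = ρ S) ∧
    ¬ ∃ f : DPMsg ρ 1 (ZMod 2) →ₗ[ZMod 2] (Fin 5 → ZMod 2), SolvesDP ρ ⇑f := by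
  have huniv : (Finset.univ : Finset (Fin 3)) = {0, 1, 2} := by decide
  refine ⟨⟨3, columnSpaces, fun S => ?_⟩, ?_⟩
  · have e12 : columnSpaces 1 ⊔ columnSpaces 2 = columnSpaces 1 :=
      sup_eq_left.2 columnSpaces_two_le_one
    have hrank {W : Submodule (ZMod 2) (Fin 3 → ZMod 2)} (hW : ∑ i ∈ S, columnSpaces i = W)
        (h : Module.finrank (ZMod 2) W = ρ S) :
        Module.finrank (ZMod 2) ↥(∑ i ∈ S, columnSpaces i) = ρ S := hW ▸ h
    rcases finset_fin_three_cases S with rfl | rfl | rfl | rfl | rfl | rfl | rfl | rfl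
    · exact hrank (W := ⊥) (by simp) (by rw [finrank_bot, hρ.1])
    · exact hrank (by simp) (finrank_columnSpaces_zero.trans h1.symm)
    · exact hrank (by simp) (finrank_columnSpaces_one.trans h2.symm)
    · exact hrank (by simp) (finrank_columnSpaces_two.trans h3.symm)
    · exact hrank (W := ⊤) (by simp [columnSpaces_zero_sup_one]) (by rw [finrank_top, h12]; simp)
    · exact hrank (W := ⊤) (by simp [columnSpaces_zero_sup_two]) (by rw [finrank_top, h13]; simp)
    · exact hrank (by simp [e12]) (finrank_columnSpaces_one.trans h23.symm)
    · exact hrank (W := ⊤) (by simp [columnSpaces_zero_sup_one, e12])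
        (by rw [finrank_top, h123]; simp)
  · rintro ⟨f, hR1, hR2, hR3⟩
    let a : Fin (ρ {0}) := ⟨0, by omega⟩
    let a' : Fin (ρ {0}) := ⟨1, by omega⟩
    let p : Fin (ρ {1}) := ⟨0, by omega⟩
    let q : Fin (ρ {1}) := ⟨1, by omega⟩
    let c : Fin (ρ {2}) := ⟨0, by omega⟩
    let g : DPMsg ρ 1 (ZMod 2) →ₗ[ZMod 2] (Fin 3 → ZMod 2) :=
      { toFun := fun z => ![z.2 0 a 0, z.2 1 p 0, z.2 1 q 0]
        map_add' := fun _ _ => by simp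
        map_smul' := fun _ _ => by simp }
    have hinj : Function.Injective (f.prod g) := by
      refine (injective_iff_map_eq_zero _).2 fun z hz => ?_
      obtain ⟨hf, hg⟩ := Prod.ext_iff.1 hz
      have ha : z.2 0 a 0 = 0 := congrFun hg 0
      have hp : z.2 1 p 0 = 0 := congrFun hg 1
      have hq : z.2 1 q 0 = 0 := congrFun hg 2
      have hf : f z = f 0 := by simpa using hf
      have hx : z.1 = 0 := by
        ext1 j
        let η : (i : Fin 3) → Finset (Fin (ρ {i})) := fun
          | 0 => {a}
          | 1 => Finset.univ
          | 2 => ∅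
        obtain ⟨ψ, hψ⟩ := hR1 _ (isBasisVec_one_two_zero h1 h2 h3 h12 h13 h23 h123) j η (by
          intro i
          fin_cases i <;> simp [η, h2])
        have key : (fun (i : Fin 3) (s : {s // s ∈ η i}) => z.2 i s) =
            fun (i : Fin 3) (s : {s // s ∈ η i}) => (0 : DPMsg ρ 1 (ZMod 2)).2 i s := by
          funext i ⟨s, hs⟩ t
          obtain rfl : t = 0 := Subsingleton.elim _ _
          fin_cases i
          · obtain rfl : s = a := by simpa [η] using hs
            exact ha
          · obtain rfl | rfl : s = p ∨ s = q := by
              have := s.2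
              simp only [p, q, Fin.ext_iff]
              change s.1 < ρ {1} at this
              omega
            · exact hp
            · exact hq
          · simp [η] at hs
        rw [← hψ z, key, hf, hψ 0]
        rfl
      refine Prod.ext hx ?_
      funext i s
      obtain ⟨ψ, hψ⟩ := hR3 i s
      rw [← hψ z, hx, hf]
      exact hψ 0
    have hdim : Module.finrank (ZMod 2) (DPMsg ρ 1 (ZMod 2)) =
        Module.finrank (ZMod 2) ((Fin 5 → ZMod 2) × (Fin 3 → ZMod 2)) := by
      simp [Module.finrank_pi_fintype, *]
    obtain ⟨z, hz⟩ :=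
      (LinearMap.injective_iff_surjective_of_finrank_eq_finrank hdim).1 hinj (0, ![1, 1, 0])
    obtain ⟨hf, hg⟩ := Prod.ext_iff.1 hz
    have ha : z.2 0 a 0 = 1 := congrFun hg 0
    have hp : z.2 1 p 0 = 1 := congrFun hg 1
    have hq : z.2 1 q 0 = 0 := congrFun hg 2
    have hf : f z = f 0 := by simpa using hf
    have key (s : Fin (ρ {1})) : z.2 0 a' 0 + z.2 1 s 0 + z.2 2 c 0 ≠ 0 := by
      intro h0
      let η : (i : Fin 3) → Finset (Fin (ρ {i})) := fun
        | 0 => {a'}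
        | 1 => {s}
        | 2 => {c}
      obtain ⟨ψ, hψ⟩ := hR2 _ (isMinExcludedVec_two_one_one h1 h2 h3 h12 h13 h23 h123) 0
        (by simp) a η (by
          intro i hi
          fin_cases i
          · exact absurd rfl hi
          · simp [η]
          · simp [η]) (by simp [η, a, a']) (by simp [η])
      have hsum : ∑ i : Fin 3, ∑ r ∈ η i, z.2 i r =
          ∑ i : Fin 3, ∑ r ∈ η i, (0 : DPMsg ρ 1 (ZMod 2)).2 i r := by
        ext t
        obtain rfl : t = 0 := Subsingleton.elim _ _
        simpa [Fin.sum_univ_three, η] using h0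
      have hz0 := hψ z
      rw [hsum, hf, hψ 0] at hz0
      have : (0 : ZMod 2) = z.2 0 a 0 := congrFun hz0 0
      rw [ha] at this
      exact zero_ne_one this
    have kp := key p
    have kq := key q
    rw [hp] at kp
    rw [hq] at kq
    generalize z.2 0 a' 0 = u at kp kq
    generalize z.2 2 c 0 = w at kp kq
    revert u w
    decide
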